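/- Let H be a nonempty proper tropically convex subset of ℝ≥0^n. Then H is a hemispace if and only if there exist nonempty disjoint sets I, J with I ∪ J = {1,…,n+1} and n+1 ∈ I (so J ⊆ {1,…,n}), and an admissible family (σ⁻_{ij})_{i∈I, j∈J} satisfying the rank-one condition (with σ⁺_{ij} := [0,∞] \ σ⁻_{ij}), such that, writing F⁻ := conv({λ·e^j : j ∈ J, λ ∈ σ⁻_{n+1,j}}) ⊕ cone({e^i ⊕ λ·e^j : i ∈ I \ {n+1}, j ∈ J, λ ∈ σ⁻_{ij}}) and F⁺ := conv({λ·e^j : j ∈ J, λ ∈ σ⁺_{n+1,j}, λ ≠ +∞}) ⊕ cone({e^i ⊕ λ·e^j : i ∈ I \ {n+1}, j ∈ J, λ ∈ σ⁺_{ij}}), with the convention e^i ⊕ (+∞)·e^j := e^j, the following holds: if 0 ∈ H then H = F⁻ and ℝ≥0^n \ H = F⁺, and if 0 ∉ H then H = F⁺ and ℝ≥0^n \ H = F⁻. (All vectors and unit vectors e^j here lie in ℝ≥0^n.) -/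

import Mathlib

open scoped NNReal

/-- A set in `ℝ≥0^n` is tropically convex (max-times model). -/
def TropConvex {n : ℕ} (C : Set (Fin n → ℝ≥0)) : Prop :=
  ∀ x ∈ C, ∀ y ∈ C, ∀ α β : ℝ≥0, max α β = 1 →
    (fun i => max (α * x i) (β * y i)) ∈ C

/-- A tropical cone: a nonempty set closed under coordinatewise max and scalar multiplication. -/
def TropCone {n : ℕ} (V : Set (Fin n → ℝ≥0)) : Prop :=
  V.Nonempty ∧ (∀ x ∈ V, ∀ y ∈ V, (fun i => max (x i) (y i)) ∈ V) ∧
    ∀ x ∈ V, ∀ lam : ℝ≥0, (fun i => lam * x i) ∈ V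

/-- Support of a vector. -/
def supp {n : ℕ} (x : Fin n → ℝ≥0) : Set (Fin n) := {i | x i ≠ 0}

/-- Quasisector of type `i` at `y`. -/
def quasiSector {n : ℕ} (y : Fin n → ℝ≥0) (i : Fin n) : Set (Fin n → ℝ≥0) :=
  {x | (∀ j ∈ supp y, x j * y i ≤ x i * y j) ∧ ∀ j ∉ supp y, x j = 0}


/-- Sector of type `i ∈ supp y` at `y`. -/
def sector {n : ℕ} (y : Fin n → ℝ≥0) (i : Fin n) : Set (Fin n → ℝ≥0) :=
  {x | (∀ j ∈ supp y, x j * y i ≤ x i * y j) ∧ y i ≤ x i ∧ ∀ j ∉ supp y, x j = 0}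

/-- Sector of type `n+1` at `y`. -/
def sectorTop {n : ℕ} (y : Fin n → ℝ≥0) : Set (Fin n → ℝ≥0) :=
  {x | ∀ j, x j ≤ y j}

/-- The `i`-th unit vector. -/
def unitVec {n : ℕ} (i : Fin n) : Fin n → ℝ≥0 := fun k => if k = i then 1 else 0

/-- The vector `e^i ⊕ λ e^j` (i-th coordinate `max 1 (λ·[i=j])`, j-th coordinate `λ`). -/
def duet {n : ℕ} (i j : Fin n) (lam : ℝ≥0) : Fin n → ℝ≥0 :=
  fun k => max (unitVec i k) (lam * unitVec j k)

/-- Tropical linear span (cone generated by `R`): all finite tropical linear combinations. -/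
def tropSpan {n : ℕ} (R : Set (Fin n → ℝ≥0)) : Set (Fin n → ℝ≥0) :=
  {x | ∃ (m : ℕ) (r : Fin m → Fin n → ℝ≥0) (l : Fin m → ℝ≥0),
    (∀ k, r k ∈ R) ∧ x = fun i => Finset.univ.sup fun k => l k * r k i}

/-- Tropical convex hull: all finite tropical convex combinations. -/
def tropConv {n : ℕ} (P : Set (Fin n → ℝ≥0)) : Set (Fin n → ℝ≥0) :=
  {x | ∃ (m : ℕ) (p : Fin m → Fin n → ℝ≥0) (l : Fin m → ℝ≥0),
    (∀ k, p k ∈ P) ∧ Finset.univ.sup l = 1 ∧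
    x = fun i => Finset.univ.sup fun k => l k * p k i}

/-- Tropical Minkowski sum of two sets. -/
def tropMink {n : ℕ} (A B : Set (Fin n → ℝ≥0)) : Set (Fin n → ℝ≥0) :=
  {z | ∃ a ∈ A, ∃ b ∈ B, z = fun i => max (a i) (b i)}

open scoped ENNReal Pointwise

/-- A conical hemispace: a tropical cone whose complement, enlarged with `0`, is also a
tropical cone. -/
def IsConicalHemispace {n : ℕ} (V : Set (Fin n → ℝ≥0)) : Prop :=
  TropCone V ∧ ∃ V2 : Set (Fin n → ℝ≥0), TropCone V2 ∧ V ∩ V2 = {0} ∧ V ∪ V2 = Set.univ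

/-- An admissible boundary set: a nonempty proper subset of `[0,∞]` of the form
`{λ ∈ ℝ≥0 | λ ≤ s}` or `{λ ∈ ℝ≥0 | λ < s}` for some `s ∈ [0,∞]`. -/
def AdmissibleSet (S : Set ℝ≥0∞) : Prop :=
  S.Nonempty ∧ S ≠ Set.univ ∧
    ∃ s : ℝ≥0∞, S = {l | l ≠ ⊤ ∧ l ≤ s} ∨ S = {l | l ≠ ⊤ ∧ l < s}

/-- The vector `e^i ⊕ λ e^j` for `λ ∈ [0,∞]`, with the convention `e^i ⊕ (+∞)·e^j := e^j`. -/
noncomputable def duetE {n : ℕ} (i j : Fin n) (lam : ℝ≥0∞) : Fin n → ℝ≥0 :=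
  if lam = ⊤ then unitVec j else duet i j lam.toNNReal

/-- A hemispace: a tropically convex set whose complement is tropically convex. -/
def IsHemispace {n : ℕ} (H : Set (Fin n → ℝ≥0)) : Prop :=
  TropConvex H ∧ TropConvex Hᶜ

/-- Membership in the index set `I = {n+1} ∪ ([n] \ J)`, where `none` plays the role of
the extra index `n+1` and `some i` that of `i ∈ [n]`. -/
def inIopt {n : ℕ} (J : Set (Fin n)) : Option (Fin n) → Prop
  | none => True
  | some i => i ∉ J

/-- The set `F⁻ = conv({λ e^j : j ∈ J, λ ∈ σ⁻_{n+1,j}}) ⊕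
cone({e^i ⊕ λ e^j : i ∈ I \ {n+1}, j ∈ J, λ ∈ σ⁻_{ij}})`. -/
noncomputable def Fminus {n : ℕ} (J : Set (Fin n))
    (σm : Option (Fin n) → Fin n → Set ℝ≥0∞) : Set (Fin n → ℝ≥0) :=
  tropMink
    (tropConv {v | ∃ j ∈ J, ∃ lam ∈ σm none j, v = fun k => lam.toNNReal * unitVec j k})
    (tropSpan {v | ∃ i, i ∉ J ∧ ∃ j ∈ J, ∃ lam ∈ σm (some i) j, v = duetE i j lam})

/-- The set `F⁺ = conv({λ e^j : j ∈ J, λ ∈ σ⁺_{n+1,j}, λ ≠ +∞}) ⊕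
cone({e^i ⊕ λ e^j : i ∈ I \ {n+1}, j ∈ J, λ ∈ σ⁺_{ij}})`. -/
noncomputable def Fplus {n : ℕ} (J : Set (Fin n))
    (σm : Option (Fin n) → Fin n → Set ℝ≥0∞) : Set (Fin n → ℝ≥0) :=
  tropMink
    (tropConv {v | ∃ j ∈ J, ∃ lam ∈ (σm none j)ᶜ, lam ≠ ⊤ ∧
        v = fun k => lam.toNNReal * unitVec j k})
    (tropSpan {v | ∃ i, i ∉ J ∧ ∃ j ∈ J, ∃ lam ∈ (σm (some i) j)ᶜ, v = duetE i j lam})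

/-! ### Finite suprema of vectors -/

section Vectors

variable {ι : Type*}

theorem smul_sup_vec (c : ℝ≥0) (x y : ι → ℝ≥0) : c • (x ⊔ y) = c • x ⊔ c • y := by
  ext i
  simp [mul_max]

theorem smul_single_le [DecidableEq ι] (x : ι → ℝ≥0) (k : ι) :
    x k • (Pi.single k 1 : ι → ℝ≥0) ≤ x := by
  intro i
  by_cases h : i = k
  · subst h; simp
  · simp [h]

theorem smul_single_self [DecidableEq ι] (x : ι → ℝ≥0) (k : ι) :
    (x k • (Pi.single k 1 : ι → ℝ≥0)) k = x k := by
  simp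

theorem sup_finset_sup_mem {κ : Type*} {S : Set (ι → ℝ≥0)} {a : ι → ℝ≥0} (ha : a ∈ S)
    (t : Finset κ) (p : κ → ι → ℝ≥0) (hp : ∀ k ∈ t, ∀ s ∈ S, s ⊔ p k ∈ S) :
    a ⊔ t.sup p ∈ S := by
  classical
  induction t using Finset.induction_on with
  | empty => simpa using ha
  | insert k t _ ih =>
    rw [Finset.sup_insert, sup_comm (p k), ← sup_assoc]
    exact hp k (by simp) _ (ih fun k hk => hp k (by simp [hk]))

/-- A vector lies in `S` as soon as each of its coordinates is reached by a vector below it which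
can be absorbed by `S`. -/
theorem mem_of_forall_coord [Fintype ι] {S : Set (ι → ℝ≥0)} {x a : ι → ℝ≥0} (ha : a ∈ S)
    (hax : a ≤ x) (h : ∀ k, ∃ p ≤ x, p k = x k ∧ ∀ s ∈ S, s ⊔ p ∈ S) : x ∈ S := by
  choose p hle heq hS using h
  have hx : x = a ⊔ Finset.univ.sup p := by
    apply le_antisymm
    · intro k
      rw [← heq k]
      exact (Finset.le_sup (f := p) (Finset.mem_univ k) k).trans (le_sup_right (a := a) k)
    · exact sup_le hax (Finset.sup_le fun k _ => hle k)
  rw [hx]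
  exact sup_finset_sup_mem ha _ _ fun k _ => hS k

end Vectors

/-! ### Complementary tropical cones -/

/-- `V` is closed under tropical linear combinations and `Vᶜ` under tropical linear combinations
with nonzero coefficients. -/
structure IsConePartition {ι : Type*} (V : Set (ι → ℝ≥0)) : Prop where
  sup_mem : ∀ x ∈ V, ∀ y ∈ V, x ⊔ y ∈ V
  smul_mem : ∀ (c : ℝ≥0), ∀ x ∈ V, c • x ∈ V
  sup_notMem : ∀ x ∉ V, ∀ y ∉ V, x ⊔ y ∉ V
  smul_notMem : ∀ c : ℝ≥0, c ≠ 0 → ∀ x ∉ V, c • x ∉ V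

namespace IsConePartition

variable {ι : Type*} [DecidableEq ι] {V : Set (ι → ℝ≥0)}

theorem exists_pair_mem [Fintype ι] (hV : IsConePartition V) {x : ι → ℝ≥0} (hx : x ∈ V) {j : ι}
    (hj : Pi.single j 1 ∉ V) (hxj : x j ≠ 0) :
    ∃ i, Pi.single i 1 ∈ V ∧ x i ≠ 0 ∧
      x i • (Pi.single i 1 : ι → ℝ≥0) ⊔ x j • Pi.single j 1 ∈ V := by
  by_contra! hcon
  refine (?_ : x ∈ Vᶜ) hx
  refine mem_of_forall_coord (hV.smul_notMem _ hxj _ hj) (smul_single_le x j) fun k => ?_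
  by_cases hk0 : x k = 0
  · exact ⟨0, zero_le, hk0.symm, fun s hs => by simpa using hs⟩
  by_cases hk : Pi.single k 1 ∈ V
  · refine ⟨_, sup_le (smul_single_le x k) (smul_single_le x j), ?_,
      fun s hs => hV.sup_notMem _ hs _ (hcon k hk hk0)⟩
    exact le_antisymm (sup_le (smul_single_le x k) (smul_single_le x j) k) (by simp)
  · exact ⟨_, smul_single_le x k, smul_single_self x k,
      fun s hs => hV.sup_notMem _ hs _ (hV.smul_notMem _ hk0 _ hk)⟩

theorem exists_pair_notMem [Fintype ι] (hV : IsConePartition V) {x : ι → ℝ≥0} (hx : x ∉ V)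
    {i : ι} (hi : Pi.single i 1 ∈ V) :
    ∃ j, Pi.single j 1 ∉ V ∧
      x i • (Pi.single i 1 : ι → ℝ≥0) ⊔ x j • Pi.single j 1 ∉ V := by
  by_contra! hcon
  refine hx (mem_of_forall_coord (hV.smul_mem (x i) _ hi) (smul_single_le x i) fun k => ?_)
  by_cases hk : Pi.single k 1 ∈ V
  · exact ⟨_, smul_single_le x k, smul_single_self x k,
      fun s hs => hV.sup_mem _ hs _ (hV.smul_mem _ _ hk)⟩
  · refine ⟨_, sup_le (smul_single_le x i) (smul_single_le x k), ?_,
      fun s hs => hV.sup_mem _ hs _ (hcon k hk)⟩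
    exact le_antisymm (sup_le (smul_single_le x i) (smul_single_le x k) k) (by simp)

/-- The scalars `l` for which `e^i ⊕ l e^j` belongs to `V`. -/
def scalars (V : Set (ι → ℝ≥0)) (i j : ι) : Set ℝ≥0∞ :=
  {l | l ≠ ⊤ ∧ (Pi.single i 1 ⊔ l.toNNReal • Pi.single j 1 : ι → ℝ≥0) ∈ V}

theorem coe_mem_scalars {i j : ι} {l : ℝ≥0} :
    (l : ℝ≥0∞) ∈ scalars V i j ↔ (Pi.single i 1 ⊔ l • Pi.single j 1 : ι → ℝ≥0) ∈ V := by
  simp [scalars]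

theorem zero_mem_scalars {i : ι} (j : ι) (hi : Pi.single i 1 ∈ V) : 0 ∈ scalars V i j := by
  simpa [scalars] using hi

theorem scalars_downward (hV : IsConePartition V) {i j : ι} (hi : Pi.single i 1 ∈ V)
    {l m : ℝ≥0∞} (hl : l ∈ scalars V i j) (hml : m ≤ l) : m ∈ scalars V i j := by
  obtain ⟨hl', hlV⟩ := hl
  lift l to ℝ≥0 using hl'
  lift m to ℝ≥0 using (hml.trans_lt ENNReal.coe_lt_top).ne
  rw [coe_mem_scalars]
  rw [ENNReal.toNNReal_coe] at hlV
  have hml' : m ≤ l := by exact_mod_cast hml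
  rcases eq_or_ne l 0 with h0 | h0
  · obtain rfl : m = 0 := le_antisymm (hml'.trans h0.le) zero_le
    simpa using hi
  have hdiv : m / l ≤ 1 := div_le_one_of_le₀ hml' zero_le
  convert hV.sup_mem _ hi _ (hV.smul_mem (m / l) _ hlV) using 1
  rw [smul_sup_vec, ← sup_assoc, smul_smul, div_mul_cancel₀ _ h0]
  congr 1
  refine (sup_eq_left.mpr fun k => ?_).symm
  simpa using mul_le_mul_of_nonneg_right hdiv (zero_le (a := (Pi.single i 1 : ι → ℝ≥0) k))

theorem admissibleSet_scalars (hV : IsConePartition V) {i : ι} (j : ι)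
    (hi : Pi.single i 1 ∈ V) : AdmissibleSet (scalars V i j) := by
  refine ⟨⟨0, zero_mem_scalars j hi⟩, fun h => ?_, sSup (scalars V i j), ?_⟩
  · exact (h ▸ Set.mem_univ (⊤ : ℝ≥0∞) : ⊤ ∈ scalars V i j).1 rfl
  by_cases hs : sSup (scalars V i j) ∈ scalars V i j
  · left
    ext l
    exact ⟨fun hl => ⟨hl.1, le_sSup hl⟩, fun hl => hV.scalars_downward hi hs hl.2⟩
  · right
    ext l
    refine ⟨fun hl => ⟨hl.1, (le_sSup hl).lt_of_ne fun h => hs (h ▸ hl)⟩, fun hl => ?_⟩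
    obtain ⟨m, hm, hlm⟩ := lt_sSup_iff.mp hl.2
    exact hV.scalars_downward hi hm hlm.le

theorem scalars_rank_one (hV : IsConePartition V) {i₁ i₂ : ι} (j₁ j₂ : ι)
    (hi₁ : Pi.single i₁ 1 ∈ V) (hi₂ : Pi.single i₂ 1 ∈ V) :
    ((scalars V i₁ j₂)ᶜ * (scalars V i₂ j₁)ᶜ) ∩ (scalars V i₁ j₁ * scalars V i₂ j₂) = ∅ := by
  rw [Set.eq_empty_iff_forall_notMem]
  rintro _ ⟨⟨l, hl, l', hl', rfl⟩, m, ⟨hmt, hm⟩, m', ⟨hmt', hm'⟩, heq⟩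
  have hl0 : l ≠ 0 := fun h => hl (h ▸ zero_mem_scalars j₂ hi₁)
  have hl0' : l' ≠ 0 := fun h => hl' (h ▸ zero_mem_scalars j₁ hi₂)
  dsimp only at heq
  have htop : l * l' ≠ ⊤ := heq ▸ ENNReal.mul_ne_top hmt hmt'
  have hlt : l ≠ ⊤ := fun h => htop (by rw [h, ENNReal.top_mul hl0'])
  have hlt' : l' ≠ ⊤ := fun h => htop (by rw [h, ENNReal.mul_top hl0])
  lift l to ℝ≥0 using hlt
  lift l' to ℝ≥0 using hlt'
  lift m to ℝ≥0 using hmt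
  lift m' to ℝ≥0 using hmt'
  rw [Set.mem_compl_iff, coe_mem_scalars] at hl hl'
  rw [ENNReal.toNNReal_coe] at hm hm'
  norm_cast at heq hl0 hl0'
  have hm0' : m' ≠ 0 := by
    rintro rfl
    rw [mul_zero] at heq
    exact mul_ne_zero hl0 hl0' heq.symm
  have hb : l / m' ≠ 0 := div_ne_zero hl0 hm0'
  refine hV.sup_notMem _ hl _ (hV.smul_notMem _ hb _ hl') ?_
  convert hV.sup_mem _ hm _ (hV.smul_mem (l / m') _ hm') using 1
  rw [smul_sup_vec, smul_sup_vec, smul_smul, smul_smul, div_mul_cancel₀ _ hm0',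
    show l / m' * l' = m by rw [div_mul_eq_mul_div, ← heq, mul_div_cancel_right₀ _ hm0'],
    sup_sup_sup_comm, sup_comm (l • _), sup_sup_sup_comm]

end IsConePartition

/-! ### Sums of a tropical polytope and a tropical cone -/

section Decomposition

variable {n : ℕ}

theorem TropConvex.sup_smul_mem {C : Set (Fin n → ℝ≥0)} (hC : TropConvex C) {x y : Fin n → ℝ≥0}
    (hx : x ∈ C) (hy : y ∈ C) {c : ℝ≥0} (hc : c ≤ 1) : x ⊔ c • y ∈ C := by
  convert hC x hx y hy 1 c (max_eq_left hc) using 1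
  ext i
  simp

theorem TropConvex.sup_mem {C : Set (Fin n → ℝ≥0)} (hC : TropConvex C) {x y : Fin n → ℝ≥0}
    (hx : x ∈ C) (hy : y ∈ C) : x ⊔ y ∈ C := by
  simpa using hC.sup_smul_mem hx hy le_rfl

theorem mem_tropSpan_iff {R : Set (Fin n → ℝ≥0)} {x : Fin n → ℝ≥0} :
    x ∈ tropSpan R ↔ ∃ (m : ℕ) (r : Fin m → Fin n → ℝ≥0) (l : Fin m → ℝ≥0),
      (∀ k, r k ∈ R) ∧ x = Finset.univ.sup fun k => l k • r k := by
  simp only [tropSpan, Set.mem_ofPred_eq, funext_iff, Finset.sup_apply, Pi.smul_apply, smul_eq_mul]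

theorem mem_tropConv_iff {P : Set (Fin n → ℝ≥0)} {x : Fin n → ℝ≥0} :
    x ∈ tropConv P ↔ ∃ (m : ℕ) (p : Fin m → Fin n → ℝ≥0) (l : Fin m → ℝ≥0),
      (∀ k, p k ∈ P) ∧ Finset.univ.sup l = 1 ∧ x = Finset.univ.sup fun k => l k • p k := by
  simp only [tropConv, Set.mem_ofPred_eq, funext_iff, Finset.sup_apply, Pi.smul_apply, smul_eq_mul]

theorem Fin.univ_sup_snoc {α : Type*} [SemilatticeSup α] [OrderBot α] {m : ℕ} (f : Fin m → α)
    (a : α) : (Finset.univ.sup (Fin.snoc f a : Fin (m + 1) → α)) = Finset.univ.sup f ⊔ a := by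
  apply le_antisymm
  · refine Finset.sup_le fun k _ => ?_
    induction k using Fin.lastCases with
    | last => simp
    | cast k => simpa using le_sup_of_le_left (Finset.le_sup (f := f) (Finset.mem_univ k))
  · refine sup_le (Finset.sup_le fun k _ => ?_) ?_
    · simpa using Finset.le_sup (f := (Fin.snoc f a : Fin (m + 1) → α))
        (Finset.mem_univ k.castSucc)
    · simpa using Finset.le_sup (f := (Fin.snoc f a : Fin (m + 1) → α))
        (Finset.mem_univ (Fin.last m))

theorem snoc_smul_snoc {m : ℕ} (l : Fin m → ℝ≥0) (p : Fin m → Fin n → ℝ≥0) (c : ℝ≥0)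
    (q : Fin n → ℝ≥0) :
    (fun k => (Fin.snoc l c : Fin (m + 1) → ℝ≥0) k •
      (Fin.snoc p q : Fin (m + 1) → Fin n → ℝ≥0) k) =
      (Fin.snoc (fun k => l k • p k) (c • q) : Fin (m + 1) → Fin n → ℝ≥0) := by
  ext1 k
  induction k using Fin.lastCases <;> simp

theorem forall_snoc_mem {α : Type*} {S : Set α} {m : ℕ} {p : Fin m → α} (hp : ∀ k, p k ∈ S)
    {q : α} (hq : q ∈ S) (k : Fin (m + 1)) : (Fin.snoc p q : Fin (m + 1) → α) k ∈ S := by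
  induction k using Fin.lastCases <;> simp [hp, hq]

theorem zero_mem_tropSpan (R : Set (Fin n → ℝ≥0)) : (0 : Fin n → ℝ≥0) ∈ tropSpan R :=
  mem_tropSpan_iff.mpr ⟨0, Fin.elim0, Fin.elim0, fun k => k.elim0, by simp; rfl⟩

theorem sup_smul_mem_tropSpan {R : Set (Fin n → ℝ≥0)} {x r : Fin n → ℝ≥0} (hx : x ∈ tropSpan R)
    (hr : r ∈ R) (c : ℝ≥0) : x ⊔ c • r ∈ tropSpan R := by
  obtain ⟨m, q, l, hq, rfl⟩ := mem_tropSpan_iff.mp hx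
  refine mem_tropSpan_iff.mpr ⟨m + 1, Fin.snoc q r, Fin.snoc l c, forall_snoc_mem hq hr, ?_⟩
  rw [snoc_smul_snoc, Fin.univ_sup_snoc]

theorem subset_tropConv (P : Set (Fin n → ℝ≥0)) : P ⊆ tropConv P := fun p hp =>
  mem_tropConv_iff.mpr ⟨1, fun _ => p, fun _ => 1, fun _ => hp, by simp, by simp⟩

theorem sup_smul_mem_tropConv {P : Set (Fin n → ℝ≥0)} {x p : Fin n → ℝ≥0} (hx : x ∈ tropConv P)
    (hp : p ∈ P) {c : ℝ≥0} (hc : c ≤ 1) : x ⊔ c • p ∈ tropConv P := by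
  obtain ⟨m, q, l, hq, hl, rfl⟩ := mem_tropConv_iff.mp hx
  refine mem_tropConv_iff.mpr ⟨m + 1, Fin.snoc q p, Fin.snoc l c, forall_snoc_mem hq hp, ?_, ?_⟩
  · rw [Fin.univ_sup_snoc, hl, sup_eq_left.mpr hc]
  · rw [snoc_smul_snoc, Fin.univ_sup_snoc]

variable {P R : Set (Fin n → ℝ≥0)}

theorem subset_tropMink : P ⊆ tropMink (tropConv P) (tropSpan R) := fun p hp =>
  ⟨p, subset_tropConv P hp, 0, zero_mem_tropSpan R, by ext; simp⟩

theorem sup_smul_mem_tropMink_left {s p : Fin n → ℝ≥0}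
    (hs : s ∈ tropMink (tropConv P) (tropSpan R)) (hp : p ∈ P) {c : ℝ≥0} (hc : c ≤ 1) :
    s ⊔ c • p ∈ tropMink (tropConv P) (tropSpan R) := by
  obtain ⟨a, ha, b, hb, rfl⟩ := hs
  exact ⟨_, sup_smul_mem_tropConv ha hp hc, b, hb, sup_right_comm a b (c • p)⟩

theorem sup_smul_mem_tropMink_right {s r : Fin n → ℝ≥0}
    (hs : s ∈ tropMink (tropConv P) (tropSpan R)) (hr : r ∈ R) (c : ℝ≥0) :
    s ⊔ c • r ∈ tropMink (tropConv P) (tropSpan R) := by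
  obtain ⟨a, ha, b, hb, rfl⟩ := hs
  exact ⟨a, ha, _, sup_smul_mem_tropSpan hb hr c, sup_assoc a b (c • r)⟩

theorem tropMink_subset {C : Set (Fin n → ℝ≥0)} (hC : TropConvex C) (hP : P ⊆ C)
    (hR : ∀ s ∈ C, ∀ r ∈ R, ∀ c : ℝ≥0, s ⊔ c • r ∈ C) :
    tropMink (tropConv P) (tropSpan R) ⊆ C := by
  rintro _ ⟨a, ha, b, hb, rfl⟩
  obtain ⟨m, p, l, hp, hl, rfl⟩ := mem_tropConv_iff.mp ha
  obtain ⟨m', r, l', hr, rfl⟩ := mem_tropSpan_iff.mp hb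
  refine sup_finset_sup_mem ?_ _ _ fun k _ s hs => hR s hs _ (hr k) _
  have hne : (Finset.univ : Finset (Fin m)).Nonempty := by
    rw [Finset.nonempty_iff_ne_empty]
    intro h
    rw [h, Finset.sup_empty] at hl
    exact zero_ne_one hl
  obtain ⟨k₀, -, hk₀⟩ := Finset.exists_mem_eq_sup _ hne l
  rw [hl] at hk₀
  have hle : p k₀ ≤ Finset.univ.sup fun k => l k • p k := by
    simpa [← hk₀] using Finset.le_sup (f := fun k => l k • p k) (Finset.mem_univ k₀)
  rw [← sup_eq_right.mpr hle]
  exact sup_finset_sup_mem (hP (hp k₀)) _ _ fun k _ s hs =>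
    hC.sup_smul_mem hs (hP (hp k)) (hl ▸ Finset.le_sup (Finset.mem_univ k))

theorem tropConvex_tropMink (P R : Set (Fin n → ℝ≥0)) :
    TropConvex (tropMink (tropConv P) (tropSpan R)) := by
  have key : ∀ x ∈ tropMink (tropConv P) (tropSpan R),
      ∀ y ∈ tropMink (tropConv P) (tropSpan R), ∀ c : ℝ≥0, c ≤ 1 →
      x ⊔ c • y ∈ tropMink (tropConv P) (tropSpan R) := by
    rintro x hx _ ⟨a, ha, b, hb, rfl⟩ c hc
    obtain ⟨m, p, l, hp, hl, rfl⟩ := mem_tropConv_iff.mp ha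
    obtain ⟨m', r, l', hr, rfl⟩ := mem_tropSpan_iff.mp hb
    have hsmul : ∀ {k : ℕ} (f : Fin k → Fin n → ℝ≥0),
        c • Finset.univ.sup f = Finset.univ.sup fun i => c • f i := fun f =>
      Finset.apply_sup_eq_sup_comp (c • · : (Fin n → ℝ≥0) → _) (smul_sup_vec c) (smul_zero c)
    change x ⊔ c • (_ ⊔ _) ∈ _
    rw [smul_sup_vec, ← sup_assoc, hsmul, hsmul]
    refine sup_finset_sup_mem (sup_finset_sup_mem hx _ _ fun k _ s hs => ?_) _ _
      fun k _ s hs => ?_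
    · rw [smul_smul]
      exact sup_smul_mem_tropMink_left hs (hp k)
        (mul_le_one' hc (hl ▸ Finset.le_sup (Finset.mem_univ k)))
    · rw [smul_smul]
      exact sup_smul_mem_tropMink_right hs (hr k) _
  intro x hx y hy α β h
  rcases max_choice α β with h' | h' <;> rw [h] at h'
  · subst h'
    convert key x hx y hy β (h ▸ le_max_right _ _) using 1
    ext i
    simp
  · subst h'
    convert key y hy x hx α (h ▸ le_max_left _ _) using 1
    ext i
    simp [max_comm]

end Decomposition

/-! ### Homogenization -/

section Homogenization

variable {n : ℕ}

/-- The vector of `ℝ≥0^(n+1)` with last coordinate `t` and remaining coordinates `x`. -/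
def homVec (t : ℝ≥0) (x : Fin n → ℝ≥0) : Option (Fin n) → ℝ≥0 := fun o => o.elim t x

theorem homVec_sup (t s : ℝ≥0) (x y : Fin n → ℝ≥0) :
    homVec t x ⊔ homVec s y = homVec (t ⊔ s) (x ⊔ y) := by
  ext o; cases o <;> rfl

theorem homVec_smul (c t : ℝ≥0) (x : Fin n → ℝ≥0) : c • homVec t x = homVec (c * t) (c • x) := by
  ext o; cases o <;> rfl

theorem single_none : (Pi.single none 1 : Option (Fin n) → ℝ≥0) = homVec 1 0 := by
  ext o; cases o <;> simp [homVec]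

theorem single_some (k : Fin n) :
    (Pi.single (some k) 1 : Option (Fin n) → ℝ≥0) = homVec 0 (Pi.single k 1) := by
  ext o; cases o <;> simp [homVec, Pi.single_apply]

/-- The homogenization of a set which is star-shaped at the origin. -/
def homCone (H : Set (Fin n → ℝ≥0)) : Set (Option (Fin n) → ℝ≥0) :=
  {y | ∀ s : ℝ≥0, s * y none ≤ 1 → s • (fun i => y (some i)) ∈ H}

theorem TropConvex.smul_mem {H : Set (Fin n → ℝ≥0)} (hH : TropConvex H) (h0 : 0 ∈ H)
    {x : Fin n → ℝ≥0} (hx : x ∈ H) {c : ℝ≥0} (hc : c ≤ 1) : c • x ∈ H := by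
  have h := hH.sup_smul_mem h0 hx hc
  rwa [sup_eq_right.mpr zero_le] at h

theorem homVec_one_mem_homCone {H : Set (Fin n → ℝ≥0)} (hH : TropConvex H) (h0 : 0 ∈ H)
    {x : Fin n → ℝ≥0} : homVec 1 x ∈ homCone H ↔ x ∈ H := by
  refine ⟨fun h => ?_, fun h s hs => ?_⟩
  · simpa [homVec] using h 1 (by simp [homVec])
  · exact hH.smul_mem h0 h (by simpa [homVec] using hs)

theorem isConePartition_homCone {H : Set (Fin n → ℝ≥0)} (hH : TropConvex H)
    (hHc : TropConvex Hᶜ) : IsConePartition (homCone H) := by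
  have key : ∀ (x y : Option (Fin n) → ℝ≥0) (s t : ℝ≥0), s * x none ≤ 1 →
      s • (fun i => x (some i)) ∉ H → t * y none ≤ 1 → t • (fun i => y (some i)) ∉ H →
      s ≤ t → x ⊔ y ∉ homCone H := by
    intro x y s t hs hsH ht htH hst hxy
    have hmax : s * max (x none) (y none) ≤ 1 := by
      rw [mul_max]
      exact max_le hs ((mul_le_mul_left hst _).trans ht)
    have h := hxy s hmax
    refine (?_ : s • (fun i => (x ⊔ y) (some i)) ∈ Hᶜ) h
    have h' := hHc.sup_smul_mem hsH htH (c := s / t) (div_le_one_of_le₀ hst zero_le)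
    rcases eq_or_ne t 0 with h0 | h0
    · obtain rfl : s = 0 := le_antisymm (hst.trans h0.le) zero_le
      simpa using hsH
    rw [smul_smul, div_mul_cancel₀ _ h0, ← smul_sup_vec] at h'
    exact h'
  constructor
  · intro x hx y hy s hs
    change s * max (x none) (y none) ≤ 1 at hs
    rw [mul_max, max_le_iff] at hs
    have h := hH.sup_mem (hx s hs.1) (hy s hs.2)
    rw [← smul_sup_vec] at h
    exact h
  · intro c x hx s hs
    have h := hx (s * c) (by simpa [mul_assoc] using hs)
    rw [mul_smul] at h
    exact h
  · intro x hx y hy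
    simp only [homCone, Set.mem_ofPred_eq, not_forall] at hx hy
    obtain ⟨s, hs, hsH⟩ := hx
    obtain ⟨t, ht, htH⟩ := hy
    rcases le_total s t with hst | hst
    · exact key x y s t hs hsH ht htH hst
    · rw [sup_comm]
      exact key y x t s ht htH hs hsH hst
  · intro c hc x hx h
    refine hx fun s hs => ?_
    have h' := h (s / c) (by simpa [← mul_assoc, div_mul_cancel₀ _ hc] using hs)
    have heq : (s / c) • (fun i => (c • x) (some i)) = s • fun i => x (some i) := by
      ext i
      simp [← mul_assoc, div_mul_cancel₀ _ hc]
    rwa [heq] at h'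

theorem unitVec_eq_single (k : Fin n) : unitVec k = Pi.single k 1 := by
  ext i
  simp [unitVec, Pi.single_apply]

theorem duetE_coe (i j : Fin n) (l : ℝ≥0) :
    duetE i j l = Pi.single i 1 ⊔ l • Pi.single j 1 := by
  ext k
  simp [duetE, duet, unitVec_eq_single]

theorem duetE_top (i j : Fin n) : duetE i j ⊤ = Pi.single j 1 := by
  simp [duetE, unitVec_eq_single]

theorem smul_duetE_div (i j : Fin n) {a : ℝ≥0} (ha : a ≠ 0) (b : ℝ≥0) :
    a • duetE i j ((b / a : ℝ≥0) : ℝ≥0∞) = a • Pi.single i 1 ⊔ b • Pi.single j 1 := by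
  rw [duetE_coe, smul_sup_vec, smul_smul, mul_div_cancel₀ _ ha]

theorem single_none_sup (l : ℝ≥0) (j : Fin n) :
    (Pi.single none 1 ⊔ l • Pi.single (some j) 1 : Option (Fin n) → ℝ≥0) =
      homVec 1 (l • Pi.single j 1) := by
  rw [single_none, single_some, homVec_smul, homVec_sup, mul_zero, sup_eq_left.mpr zero_le,
    sup_eq_right.mpr zero_le]

theorem smul_single_some_sup (a b : ℝ≥0) (i j : Fin n) :
    (a • Pi.single (some i) 1 ⊔ b • Pi.single (some j) 1 : Option (Fin n) → ℝ≥0) =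
      homVec 0 (a • Pi.single i 1 ⊔ b • Pi.single j 1) := by
  rw [single_some, single_some, homVec_smul, homVec_smul, homVec_sup, mul_zero, mul_zero, sup_idem]

theorem homVec_one_sup_smul (c : ℝ≥0) (x y : Fin n → ℝ≥0) :
    homVec 1 x ⊔ c • homVec 0 y = homVec 1 (x ⊔ c • y) := by
  rw [homVec_smul, homVec_sup, mul_zero, sup_eq_left.mpr zero_le]

end Homogenization

/-! ### Hemispaces containing the origin -/

section Hemispace

open IsConePartition

variable {n : ℕ} {H : Set (Fin n → ℝ≥0)}

/-- The unit directions which are not recession directions of `H`. -/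
def nonRecession (H : Set (Fin n → ℝ≥0)) : Set (Fin n) :=
  {j | Pi.single (some j) 1 ∉ homCone H}

theorem single_none_mem_homCone (hH : TropConvex H) (h0 : 0 ∈ H) :
    Pi.single none 1 ∈ homCone H := by
  rw [single_none]
  exact (homVec_one_mem_homCone hH h0).mpr h0

theorem single_mem_homCone_of_inIopt (hH : TropConvex H) (h0 : 0 ∈ H) :
    ∀ io, inIopt (nonRecession H) io → Pi.single io 1 ∈ homCone H
  | none, _ => single_none_mem_homCone hH h0
  | some _, hi => not_not.mp hi

theorem coe_mem_scalars_none (hH : TropConvex H) (h0 : 0 ∈ H) {l : ℝ≥0} {j : Fin n} :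
    (l : ℝ≥0∞) ∈ scalars (homCone H) none (some j) ↔ l • (Pi.single j 1 : Fin n → ℝ≥0) ∈ H := by
  rw [coe_mem_scalars, single_none_sup, homVec_one_mem_homCone hH h0]

theorem coe_mem_scalars_some {l : ℝ≥0} {i j : Fin n} :
    (l : ℝ≥0∞) ∈ scalars (homCone H) (some i) (some j) ↔ homVec 0 (duetE i j l) ∈ homCone H := by
  have h := smul_single_some_sup 1 l i j
  rw [one_smul, one_smul] at h
  rw [coe_mem_scalars, h, duetE_coe]

theorem div_mem_scalars_some (hV : IsConePartition (homCone H)) {a b : ℝ≥0} (ha : a ≠ 0)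
    {i j : Fin n} :
    ((b / a : ℝ≥0) : ℝ≥0∞) ∈ scalars (homCone H) (some i) (some j) ↔
      (a • Pi.single (some i) 1 ⊔ b • Pi.single (some j) 1 : Option (Fin n) → ℝ≥0)
        ∈ homCone H := by
  have h : a • homVec 0 (duetE i j ((b / a : ℝ≥0) : ℝ≥0∞)) =
      a • Pi.single (some i) 1 ⊔ b • Pi.single (some j) 1 := by
    rw [homVec_smul, mul_zero, smul_duetE_div i j ha, smul_single_some_sup]
  rw [coe_mem_scalars_some, ← h]
  exact ⟨hV.smul_mem a _, fun h' => by_contra fun hcon => hV.smul_notMem a ha _ hcon h'⟩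

theorem exists_smul_single_notMem {j : Fin n} (hj : j ∈ nonRecession H) :
    ∃ l : ℝ≥0, l • (Pi.single j 1 : Fin n → ℝ≥0) ∉ H := by
  simp only [nonRecession, single_some, homCone, Set.mem_ofPred_eq, not_forall] at hj
  obtain ⟨l, -, hl⟩ := hj
  exact ⟨l, hl⟩

theorem nonRecession_nonempty (hH : TropConvex H) (hHc : TropConvex Hᶜ) (h0 : 0 ∈ H)
    (hne : H ≠ Set.univ) : (nonRecession H).Nonempty := by
  have hV := isConePartition_homCone hH hHc
  obtain ⟨x, hx⟩ := (Set.ne_univ_iff_exists_notMem H).mp hne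
  have hx' : homVec 1 x ∉ homCone H := fun h => hx ((homVec_one_mem_homCone hH h0).mp h)
  obtain ⟨j, hj, -⟩ := hV.exists_pair_notMem hx' (single_none_mem_homCone hH h0)
  cases j with
  | none => exact absurd (single_none_mem_homCone hH h0) hj
  | some j => exact ⟨j, hj⟩

theorem eq_Fminus (hH : TropConvex H) (hHc : TropConvex Hᶜ) (h0 : 0 ∈ H) (hne : H ≠ Set.univ) :
    H = Fminus (nonRecession H) fun io j => scalars (homCone H) io (some j) := by
  have hV := isConePartition_homCone hH hHc
  have hnone := single_none_mem_homCone hH h0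
  obtain ⟨j₀, hj₀⟩ := nonRecession_nonempty hH hHc h0 hne
  apply Set.Subset.antisymm
  · intro x hx
    refine mem_of_forall_coord (a := 0) (subset_tropMink ⟨j₀, hj₀, 0, zero_mem_scalars _ hnone, ?_⟩)
      zero_le fun k => ?_
    · ext; simp
    by_cases hk0 : x k = 0
    · exact ⟨0, zero_le, hk0.symm, fun s hs => by simpa using hs⟩
    by_cases hk : k ∈ nonRecession H
    · obtain ⟨i, hi, hi0, hik⟩ :=
        hV.exists_pair_mem ((homVec_one_mem_homCone hH h0).mpr hx) hk hk0
      cases i with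
      | none =>
        refine ⟨_, smul_single_le x k, smul_single_self x k, fun s hs => ?_⟩
        rw [← one_smul ℝ≥0 (x k • _)]
        refine sup_smul_mem_tropMink_left hs ⟨k, hk, x k, ?_, ?_⟩ le_rfl
        · rw [coe_mem_scalars]
          simpa [homVec] using hik
        · rw [unitVec_eq_single]; rfl
      | some i =>
        change x i ≠ 0 at hi0
        refine ⟨_, sup_le (smul_single_le x i) (smul_single_le x k), ?_, fun s hs => ?_⟩
        · exact le_antisymm (sup_le (smul_single_le x i) (smul_single_le x k) k) (by simp)
        · rw [← smul_duetE_div i k hi0]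
          exact sup_smul_mem_tropMink_right hs ⟨i, fun h => h hi, k, hk, _,
            (div_mem_scalars_some hV hi0).mpr hik, rfl⟩ _
    · refine ⟨_, smul_single_le x k, smul_single_self x k, fun s hs => ?_⟩
      refine sup_smul_mem_tropMink_right hs ⟨k, hk, j₀, hj₀, 0,
        zero_mem_scalars _ (not_not.mp hk), ?_⟩ _
      simpa using (duetE_coe k j₀ 0).symm
  · refine tropMink_subset hH ?_ ?_
    · rintro _ ⟨j, hj, l, hl, rfl⟩
      lift l to ℝ≥0 using hl.1
      rw [unitVec_eq_single]
      exact (coe_mem_scalars_none hH h0).mp hl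
    · rintro s hs _ ⟨i, hi, j, hj, l, hl, rfl⟩ c
      lift l to ℝ≥0 using hl.1
      rw [← homVec_one_mem_homCone hH h0, ← homVec_one_sup_smul]
      exact hV.sup_mem _ ((homVec_one_mem_homCone hH h0).mpr hs) _
        (hV.smul_mem _ _ (coe_mem_scalars_some.mp hl))

theorem compl_eq_Fplus (hH : TropConvex H) (hHc : TropConvex Hᶜ) (h0 : 0 ∈ H) :
    Hᶜ = Fplus (nonRecession H) fun io j => scalars (homCone H) io (some j) := by
  have hV := isConePartition_homCone hH hHc
  have hnone := single_none_mem_homCone hH h0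
  apply Set.Subset.antisymm
  · intro x hx
    have hx' : homVec 1 x ∉ homCone H := fun h => hx ((homVec_one_mem_homCone hH h0).mp h)
    obtain ⟨j₀, hj₀, hpair⟩ := hV.exists_pair_notMem hx' hnone
    cases j₀ with
    | none => exact absurd hnone hj₀
    | some j₀ =>
    refine mem_of_forall_coord (a := x j₀ • Pi.single j₀ 1)
      (subset_tropMink ⟨j₀, hj₀, x j₀, ?_, ENNReal.coe_ne_top, ?_⟩) (smul_single_le x j₀)
      fun k => ?_
    · rw [Set.mem_compl_iff, coe_mem_scalars]
      simpa [homVec] using hpair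
    · rw [unitVec_eq_single]; rfl
    by_cases hk0 : x k = 0
    · exact ⟨0, zero_le, hk0.symm, fun s hs => by simpa using hs⟩
    by_cases hk : k ∈ nonRecession H
    · refine ⟨_, smul_single_le x k, smul_single_self x k, fun s hs => ?_⟩
      obtain ⟨l, hl⟩ := exists_smul_single_notMem hk
      by_cases hxl : x k ≤ l
      · have hl0 : l ≠ 0 := fun h => hk0 (le_antisymm (hxl.trans h.le) zero_le)
        rw [show x k • (Pi.single k 1 : Fin n → ℝ≥0) = (x k / l) • l • Pi.single k 1 by
          rw [smul_smul, div_mul_cancel₀ _ hl0]]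
        refine sup_smul_mem_tropMink_left hs ⟨k, hk, l, fun h => ?_, ENNReal.coe_ne_top, ?_⟩
          (div_le_one_of_le₀ hxl zero_le)
        · exact hl ((coe_mem_scalars_none hH h0).mp h)
        · rw [unitVec_eq_single]; rfl
      · rw [← one_smul ℝ≥0 (x k • _)]
        refine sup_smul_mem_tropMink_left hs ⟨k, hk, x k, fun h => ?_, ENNReal.coe_ne_top, ?_⟩
          le_rfl
        · have hlx : (l : ℝ≥0∞) ≤ x k := by exact_mod_cast (not_le.mp hxl).le
          exact hl ((coe_mem_scalars_none hH h0).mp (hV.scalars_downward hnone h hlx))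
        · rw [unitVec_eq_single]; rfl
    · obtain ⟨j, hj, hkj⟩ := hV.exists_pair_notMem hx' (not_not.mp hk)
      cases j with
      | none => exact absurd hnone hj
      | some j =>
        refine ⟨_, sup_le (smul_single_le x k) (smul_single_le x j), ?_, fun s hs => ?_⟩
        · exact le_antisymm (sup_le (smul_single_le x k) (smul_single_le x j) k) (by simp)
        · rw [← smul_duetE_div k j hk0]
          exact sup_smul_mem_tropMink_right hs ⟨k, hk, j, hj, _,
            fun h => hkj ((div_mem_scalars_some hV hk0).mp h), rfl⟩ _
  · refine tropMink_subset hHc ?_ ?_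
    · rintro _ ⟨j, hj, l, hl, hlt, rfl⟩ h
      lift l to ℝ≥0 using hlt
      rw [unitVec_eq_single] at h
      exact hl ((coe_mem_scalars_none hH h0).mpr h)
    · rintro s hs r ⟨i, hi, j, hj, l, hl, rfl⟩ c
      rcases eq_or_ne c 0 with rfl | hc
      · simpa using hs
      have hr : homVec 0 (duetE i j l) ∉ homCone H := by
        rcases eq_or_ne l ⊤ with rfl | hlt
        · rw [duetE_top, ← single_some]
          exact hj
        · lift l to ℝ≥0 using hlt
          exact fun h => hl (coe_mem_scalars_some.mpr h)
      rw [Set.mem_compl_iff, ← homVec_one_mem_homCone hH h0, ← homVec_one_sup_smul]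
      exact hV.sup_notMem _ (fun h => hs ((homVec_one_mem_homCone hH h0).mp h)) _
        (hV.smul_notMem _ hc _ hr)

theorem exists_decomposition (hH : TropConvex H) (hHc : TropConvex Hᶜ) (h0 : 0 ∈ H)
    (hne : H ≠ Set.univ) :
    ∃ (J : Set (Fin n)) (σm : Option (Fin n) → Fin n → Set ℝ≥0∞),
      J.Nonempty ∧
      (∀ io, inIopt J io → ∀ j ∈ J, AdmissibleSet (σm io j)) ∧
      (∀ io1, inIopt J io1 → ∀ io2, inIopt J io2 → ∀ j1 ∈ J, ∀ j2 ∈ J,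
        ((σm io1 j2)ᶜ * (σm io2 j1)ᶜ) ∩ (σm io1 j1 * σm io2 j2) = ∅ ∧
        (σm io1 j2 * σm io2 j1) ∩ ((σm io1 j1)ᶜ * (σm io2 j2)ᶜ) = ∅) ∧
      H = Fminus J σm ∧ Hᶜ = Fplus J σm := by
  have hV := isConePartition_homCone hH hHc
  have hI := single_mem_homCone_of_inIopt hH h0
  refine ⟨nonRecession H, fun io j => scalars (homCone H) io (some j),
    nonRecession_nonempty hH hHc h0 hne,
    fun io hio j _ => hV.admissibleSet_scalars _ (hI io hio),
    fun io₁ h₁ io₂ h₂ j₁ _ j₂ _ => ⟨hV.scalars_rank_one _ _ (hI _ h₁) (hI _ h₂), ?_⟩,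
    eq_Fminus hH hHc h0 hne, compl_eq_Fplus hH hHc h0⟩
  rw [Set.inter_comm]
  exact hV.scalars_rank_one _ _ (hI _ h₁) (hI _ h₂)

end Hemispace

theorem stmt19 {n : ℕ} (H : Set (Fin n → ℝ≥0)) (hne : H.Nonempty)
    (hproper : H ≠ Set.univ) (hconv : TropConvex H) :
    IsHemispace H ↔
      ∃ (J : Set (Fin n)) (σm : Option (Fin n) → Fin n → Set ℝ≥0∞),
        J.Nonempty ∧
        (∀ io, inIopt J io → ∀ j ∈ J, AdmissibleSet (σm io j)) ∧
        (∀ io1, inIopt J io1 → ∀ io2, inIopt J io2 → ∀ j1 ∈ J, ∀ j2 ∈ J,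
          ((σm io1 j2)ᶜ * (σm io2 j1)ᶜ) ∩ (σm io1 j1 * σm io2 j2) = ∅ ∧
          (σm io1 j2 * σm io2 j1) ∩ ((σm io1 j1)ᶜ * (σm io2 j2)ᶜ) = ∅) ∧
        ((0 ∈ H → H = Fminus J σm ∧ Hᶜ = Fplus J σm) ∧
         (0 ∉ H → H = Fplus J σm ∧ Hᶜ = Fminus J σm)) := by
  constructor
  · rintro ⟨-, hHc⟩
    by_cases h0 : 0 ∈ H
    · obtain ⟨J, σm, hJ, hadm, hrank, hF⟩ := exists_decomposition hconv hHc h0 hproper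
      exact ⟨J, σm, hJ, hadm, hrank, fun _ => hF, fun h => absurd h0 h⟩
    · obtain ⟨J, σm, hJ, hadm, hrank, hFm, hFp⟩ := exists_decomposition (H := Hᶜ) hHc
        (by rwa [compl_compl]) h0 (by simpa [Set.compl_univ_iff] using hne.ne_empty)
      rw [compl_compl] at hFp
      exact ⟨J, σm, hJ, hadm, hrank, fun h => absurd h h0, fun _ => ⟨hFp, hFm⟩⟩
  · rintro ⟨J, σm, -, -, -, hin, hout⟩
    refine ⟨hconv, ?_⟩
    by_cases h0 : 0 ∈ H
    · rw [(hin h0).2]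
      exact tropConvex_tropMink _ _
    · rw [(hout h0).2]
      exact tropConvex_tropMink _ _
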